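/- Let q ≥ 1, S ≥ q be integers and let h : [0,∞) → ℝ be nonincreasing, with h(x) = 1 for x ∈ [0,1/2], h(x) = 0 for x > 1, and h an S-times iterated integral of a function of bounded variation. Then there exist constants c, c' > 0 depending only on q and h such that for all integers n ≥ 1 and all x ∈ S^q: (i) c n^q ≤ ∫_{S^q} Φ_n(h; x·ξ)² dμ_q(ξ) ≤ c' n^q; (ii) max_{ξ∈S^q} |Φ_n(h; x·ξ)| = Φ_n(h; 1), and c n^q ≤ Φ_n(h;1) ≤ c' n^q. -/

import Mathlib

noncomputable section

open MeasureTheory Finset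

namespace SD

/-- Euclidean space `ℝ^(q+1)`. -/
abbrev Euc (q : ℕ) := EuclideanSpace ℝ (Fin (q + 1))

/-- The unit sphere `S^q ⊂ ℝ^(q+1)`, as a type. -/
abbrev Sph (q : ℕ) : Type := Metric.sphere (0 : Euc q) 1

/-- Dot product of two points of the sphere. -/
def dot {q : ℕ} (x y : Sph q) : ℝ := ∑ i, (x : Euc q) i * (y : Euc q) i

/-- Geodesic distance `arccos (x ⬝ y)` on the sphere. -/
def gdist {q : ℕ} (x y : Sph q) : ℝ := Real.arccos (dot x y)

/-- The mesh norm `δ_C(S^q)` of a finite set of points. -/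
def meshNorm {q : ℕ} (C : Finset (Sph q)) : ℝ :=
  ⨆ x : Sph q, sInf ((fun ξ => gdist x ξ) '' (C : Set (Sph q)))

/-- `f : S^q → ℝ` belongs to `Π_n^q` : it is the restriction to the sphere of an algebraic
polynomial in `q+1` variables of total degree at most `n`. -/
def InPi (q n : ℕ) (f : Sph q → ℝ) : Prop :=
  ∃ P : MvPolynomial (Fin (q + 1)) ℝ, P.totalDegree ≤ n ∧
    ∀ x : Sph q, f x = MvPolynomial.eval (fun i => (x : Euc q) i) P

/-- `f` is a spherical harmonic of degree `ℓ` : the restriction to the sphere of a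
homogeneous harmonic polynomial of degree `ℓ`. -/
def IsSphHarm (q ℓ : ℕ) (f : Sph q → ℝ) : Prop :=
  ∃ P : MvPolynomial (Fin (q + 1)) ℝ, P.IsHomogeneous ℓ ∧
    (∑ i : Fin (q + 1), MvPolynomial.pderiv i (MvPolynomial.pderiv i P)) = 0 ∧
    ∀ x : Sph q, f x = MvPolynomial.eval (fun i => (x : Euc q) i) P

/-- Rotation of a point of the sphere by a linear isometry of the ambient space. -/
def rotate {q : ℕ} (R : Euc q ≃ₗᵢ[ℝ] Euc q) (x : Sph q) : Sph q :=
  ⟨R x, by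
    have hx : ‖(x : Euc q)‖ = 1 := mem_sphere_zero_iff_norm.mp x.2
    simp [mem_sphere_zero_iff_norm, hx]⟩

/-- `μ` is invariant under all rotations of the sphere. -/
def RotInvariant (q : ℕ) (μ : Measure (Sph q)) : Prop :=
  ∀ R : Euc q ≃ₗᵢ[ℝ] Euc q, Measure.map (rotate R) μ = μ

/-- `IterIntBV S f` : `f` is an `S` times iterated integral of a function of bounded
variation (on `[0,∞)`). -/
def IterIntBV : ℕ → (ℝ → ℝ) → Prop
  | 0, f => BoundedVariationOn f (Set.Ici 0)
  | (S + 1), f => ∃ g : ℝ → ℝ, IterIntBV S g ∧ ∀ x : ℝ, 0 ≤ x → f x = f 0 + ∫ t in (0 : ℝ)..x, g t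

/-- The standing hypotheses on the filter function `h` : `h = 1` on `[0,1/2]`, `h = 0` on
`(1,∞)`, `h` nonincreasing on `[0,∞)`, and `h` an `S` times iterated integral of a function
of bounded variation. -/
def GoodH (S : ℕ) (h : ℝ → ℝ) : Prop :=
  (∀ x : ℝ, 0 ≤ x → x ≤ 1 / 2 → h x = 1) ∧
  (∀ x : ℝ, 1 < x → h x = 0) ∧
  (∀ x y : ℝ, 0 ≤ x → x ≤ y → h y ≤ h x) ∧
  IterIntBV S h

/-- `Y ℓ ·` is, for each `ℓ`, an orthonormal basis of the space of degree `ℓ` spherical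
harmonics in `L²(μ)`. -/
def GoodBasis (q : ℕ) (μ : Measure (Sph q)) (d : ℕ → ℕ)
    (Y : (ℓ : ℕ) → Fin (d ℓ) → Sph q → ℝ) : Prop :=
  (∀ ℓ k, IsSphHarm q ℓ (Y ℓ k)) ∧
  (∀ (ℓ ℓ' : ℕ) (k : Fin (d ℓ)) (k' : Fin (d ℓ')),
      ∫ x, Y ℓ k x * Y ℓ' k' x ∂μ = if ℓ = ℓ' ∧ (k : ℕ) = (k' : ℕ) then 1 else 0) ∧
  (∀ (ℓ : ℕ) (f : Sph q → ℝ), IsSphHarm q ℓ f →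
      ∃ a : Fin (d ℓ) → ℝ, ∀ x, f x = ∑ k, a k * Y ℓ k x)

/-- The kernel `Φ_n(h; x·ξ) = Σ_{ℓ=0}^n h(ℓ/n) Σ_k Y_{ℓ,k}(x) Y_{ℓ,k}(ξ)`. -/
def Phi {q : ℕ} (d : ℕ → ℕ) (Y : (ℓ : ℕ) → Fin (d ℓ) → Sph q → ℝ) (h : ℝ → ℝ) (n : ℕ)
    (x ξ : Sph q) : ℝ :=
  ∑ ℓ ∈ range (n + 1), h ((ℓ : ℝ) / (n : ℝ)) * ∑ k, Y ℓ k x * Y ℓ k ξ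

/-- The discretized operator `σ_n(C, W; h; Z, x) = Σ_{ξ∈C} w_ξ z_ξ Φ_n(h; x·ξ)`. -/
def sigmaOp {q : ℕ} (d : ℕ → ℕ) (Y : (ℓ : ℕ) → Fin (d ℓ) → Sph q → ℝ) (h : ℝ → ℝ) (n : ℕ)
    (C : Finset (Sph q)) (w : Sph q → ℝ) (z : Sph q → ℝ) (x : Sph q) : ℝ :=
  ∑ ξ ∈ C, w ξ * z ξ * Phi d Y h n x ξ

/-- The summability operator `σ*_n(h; f, x) = ∫ f(ζ) Φ_n(h; x·ζ) dμ(ζ)`. -/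
def sigmaStar {q : ℕ} (μ : Measure (Sph q)) (d : ℕ → ℕ)
    (Y : (ℓ : ℕ) → Fin (d ℓ) → Sph q → ℝ) (h : ℝ → ℝ) (n : ℕ) (f : Sph q → ℝ)
    (x : Sph q) : ℝ :=
  ∫ ζ, f ζ * Phi d Y h n x ζ ∂μ

/-- Sup norm on the sphere. -/
def supNorm {q : ℕ} (f : Sph q → ℝ) : ℝ := ⨆ x : Sph q, |f x|

/-- Sup norm on a subset of the sphere. -/
def supNormOn {q : ℕ} (K : Set (Sph q)) (f : Sph q → ℝ) : ℝ := ⨆ x ∈ K, |f x|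

/-- The spherical cap of radius `δ` centered at `x₀`. -/
def cap {q : ℕ} (x₀ : Sph q) (δ : ℝ) : Set (Sph q) := {x | gdist x x₀ ≤ δ}

/-- `C` admits a Marcinkiewicz–Zygmund quadrature of order `m` with weights `w` and
M–Z constant `c₀`. -/
def MZQuad (q : ℕ) (μ : Measure (Sph q)) (m : ℕ) (C : Finset (Sph q)) (w : Sph q → ℝ)
    (c₀ : ℝ) : Prop :=
  (∀ P : Sph q → ℝ, InPi q (2 * m) P → ∑ ξ ∈ C, w ξ * P ξ = ∫ x, P x ∂μ) ∧
  (∀ P : Sph q → ℝ, InPi q (2 * m) P → ∀ p : ℝ, 1 ≤ p →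
      (∑ ξ ∈ C, |w ξ| * |P ξ| ^ p) ^ (1 / p) ≤ c₀ * (∫ x, |P x| ^ p ∂μ) ^ (1 / p))

/-- The sequence `n ↦ 2^((n+1)r) ‖σ*_{2^(n+1)}(h;f) − σ*_{2^n}(h;f)‖_{∞,K}`. -/
def WrSeqOn {q : ℕ} (K : Set (Sph q)) (μ : Measure (Sph q)) (d : ℕ → ℕ)
    (Y : (ℓ : ℕ) → Fin (d ℓ) → Sph q → ℝ) (h : ℝ → ℝ) (r : ℝ) (f : Sph q → ℝ) (n : ℕ) : ℝ :=
  (2 : ℝ) ^ (((n : ℝ) + 1) * r) *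
    supNormOn K (fun x => sigmaStar μ d Y h (2 ^ (n + 1)) f x - sigmaStar μ d Y h (2 ^ n) f x)

/-- The norm `‖f‖_{W_r(K)}`. -/
def WrNormOn {q : ℕ} (K : Set (Sph q)) (μ : Measure (Sph q)) (d : ℕ → ℕ)
    (Y : (ℓ : ℕ) → Fin (d ℓ) → Sph q → ℝ) (h : ℝ → ℝ) (r : ℝ) (f : Sph q → ℝ) : ℝ :=
  supNorm f + ⨆ n : ℕ, WrSeqOn K μ d Y h r f n

/-- The norm `‖f‖_{W_r}`. -/
def WrNorm {q : ℕ} (μ : Measure (Sph q)) (d : ℕ → ℕ)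
    (Y : (ℓ : ℕ) → Fin (d ℓ) → Sph q → ℝ) (h : ℝ → ℝ) (r : ℝ) (f : Sph q → ℝ) : ℝ :=
  WrNormOn Set.univ μ d Y h r f

/-- Membership in `W_r(K)` : `f` is continuous and the `W_r(K)` seminorm is finite. -/
def MemWrOn {q : ℕ} (K : Set (Sph q)) (μ : Measure (Sph q)) (d : ℕ → ℕ)
    (Y : (ℓ : ℕ) → Fin (d ℓ) → Sph q → ℝ) (h : ℝ → ℝ) (r : ℝ) (f : Sph q → ℝ) : Prop :=
  Continuous f ∧ BddAbove (Set.range (WrSeqOn K μ d Y h r f))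

/-- `y` is an orthonormal basis of `Π_n^q` in `L²(μ)` (so `N = dim Π_n^q`), whose `0`-th
element is the constant polynomial `1`. -/
def GoodPolyBasis (q n N : ℕ) (μ : Measure (Sph q)) (y : Fin N → Sph q → ℝ) : Prop :=
  (∀ i, InPi q n (y i)) ∧
  (∀ i j, ∫ x, y i x * y j x ∂μ = if i = j then 1 else 0) ∧
  (∀ P : Sph q → ℝ, InPi q n P → ∃ a : Fin N → ℝ, ∀ x, P x = ∑ i, a i * y i x) ∧
  (∀ i : Fin N, (i : ℕ) = 0 → ∀ x, y i x = 1)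

/-- The Gram matrix `(G_N)_{i,j} = Σ_{ξ∈C} v_ξ y_i(ξ) y_j(ξ)`. -/
def gram {q N : ℕ} (C : Finset (Sph q)) (v : Sph q → ℝ) (y : Fin N → Sph q → ℝ) :
    Matrix (Fin N) (Fin N) ℝ :=
  Matrix.of fun i j => ∑ ξ ∈ C, v ξ * y i ξ * y j ξ

/-- The least squares quadrature weights `w_ξ^{LSQ} = v_ξ Σ_k (G_N⁻¹)_{i₀,k} y_k(ξ)`. -/
def wLSQ {q N : ℕ} (C : Finset (Sph q)) (v : Sph q → ℝ) (y : Fin N → Sph q → ℝ) (i0 : Fin N)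
    (ξ : Sph q) : ℝ :=
  v ξ * ∑ k, (gram C v y)⁻¹ i0 k * y k ξ

/-- Two–sided Marcinkiewicz–Zygmund inequalities for the masses `v` on `C`, for all
`1 ≤ p ≤ ∞`. -/
def VMZ (q n : ℕ) (μ : Measure (Sph q)) (C : Finset (Sph q)) (v : Sph q → ℝ)
    (c₁ c₂ : ℝ) : Prop :=
  (∀ P : Sph q → ℝ, InPi q n P → ∀ p : ℝ, 1 ≤ p →
      c₁ * (∫ x, |P x| ^ p ∂μ) ^ (1 / p) ≤ (∑ ξ ∈ C, v ξ * |P ξ| ^ p) ^ (1 / p) ∧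
      (∑ ξ ∈ C, v ξ * |P ξ| ^ p) ^ (1 / p) ≤ c₂ * (∫ x, |P x| ^ p ∂μ) ^ (1 / p)) ∧
  (∀ P : Sph q → ℝ, InPi q n P →
      c₁ * supNorm P ≤ (⨆ ξ ∈ (C : Set (Sph q)), |P ξ|) ∧
      (⨆ ξ ∈ (C : Set (Sph q)), |P ξ|) ≤ c₂ * supNorm P)

open MvPolynomial

/-- The Laplacian on real polynomials in `q + 1` variables. -/
def laplacian (q : ℕ) : MvPolynomial (Fin (q + 1)) ℝ →ₗ[ℝ] MvPolynomial (Fin (q + 1)) ℝ :=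
  ∑ i, (pderiv i).toLinearMap ∘ₗ (pderiv i).toLinearMap

lemma laplacian_apply {q : ℕ} (P : MvPolynomial (Fin (q + 1)) ℝ) :
    laplacian q P = ∑ i, pderiv i (pderiv i P) := by
  simp [laplacian]

/-- Restriction of polynomials to the sphere. -/
def sphereRestrict (q : ℕ) : MvPolynomial (Fin (q + 1)) ℝ →ₗ[ℝ] (Sph q → ℝ) :=
  LinearMap.pi fun x => (aeval fun i => (x : Euc q) i).toLinearMap

lemma sphereRestrict_apply {q : ℕ} (P : MvPolynomial (Fin (q + 1)) ℝ) (x : Sph q) :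
    sphereRestrict q P x = eval (fun i => (x : Euc q) i) P := by
  simp [sphereRestrict]

lemma eval_smul_of_isHomogeneous {σ : Type*} [Fintype σ] {ℓ : ℕ} {P : MvPolynomial σ ℝ}
    (hP : P.IsHomogeneous ℓ) (r : ℝ) (v : σ → ℝ) :
    eval (fun i => r * v i) P = r ^ ℓ * eval v P := by
  rw [eval_eq', eval_eq', Finset.mul_sum]
  refine Finset.sum_congr rfl fun s hs => ?_
  have h1 : ∑ i, s i = ℓ := by
    rw [← Finsupp.degree_eq_sum]
    by_contra hne
    exact (mem_support_iff.mp hs) (hP.coeff_eq_zero hne)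
  simp only [mul_pow, Finset.prod_mul_distrib, Finset.prod_pow_eq_pow_sum, h1]
  ring

lemma eq_zero_of_sphereRestrict_eq_zero {q ℓ : ℕ} {P : MvPolynomial (Fin (q + 1)) ℝ}
    (hP : P.IsHomogeneous ℓ) (h0 : sphereRestrict q P = 0) : P = 0 := by
  suffices h : X 0 * P = 0 by
    rcases mul_eq_zero.mp h with h | h
    · exact absurd h (X_ne_zero _)
    · exact h
  refine MvPolynomial.funext fun v => ?_
  rw [map_mul, eval_X, map_zero]
  by_cases hv : v = 0
  · simp [hv]
  set w : Euc q := WithLp.toLp 2 v with hw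
  have hw0 : ‖w‖ ≠ 0 := by
    rw [norm_ne_zero_iff, hw]
    simpa using hv
  let x : Sph q := ⟨‖w‖⁻¹ • w, by simp [norm_smul, hw0]⟩
  have hx := congrFun h0 x
  rw [sphereRestrict_apply] at hx
  have hvx : v = fun i => ‖w‖ * (x : Euc q) i := by
    ext i
    change v i = ‖w‖ * (‖w‖⁻¹ * v i)
    field_simp
  rw [hvx, eval_smul_of_isHomogeneous hP, hx]
  simp

instance (q ℓ : ℕ) : FiniteDimensional ℝ (homogeneousSubmodule (Fin (q + 1)) ℝ ℓ) :=
  Module.Finite.iff_fg.mpr (homogeneousSubmodule_fg _ _ ℓ)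

lemma finrank_homogeneous_le {q : ℕ} {d : ℕ → ℕ} {Y : (ℓ : ℕ) → Fin (d ℓ) → Sph q → ℝ}
    (hY : ∀ (ℓ : ℕ) (f : Sph q → ℝ), IsSphHarm q ℓ f →
      ∃ a : Fin (d ℓ) → ℝ, ∀ x, f x = ∑ k, a k * Y ℓ k x) (ℓ : ℕ) :
    Module.finrank ℝ (homogeneousSubmodule (Fin (q + 1)) ℝ ℓ) ≤
      Module.finrank ℝ (LinearMap.range ((laplacian q).domRestrict
        (homogeneousSubmodule (Fin (q + 1)) ℝ ℓ))) + d ℓ := by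
  set H := homogeneousSubmodule (Fin (q + 1)) ℝ ℓ
  set T := (laplacian q).domRestrict H
  rw [← LinearMap.finrank_range_add_finrank_ker T]
  gcongr
  let g : LinearMap.ker T →ₗ[ℝ] (Sph q → ℝ) :=
    sphereRestrict q ∘ₗ H.subtype ∘ₗ (LinearMap.ker T).subtype
  have hg : Function.Injective g := by
    rw [injective_iff_map_eq_zero]
    intro P hP
    ext1
    ext1
    exact eq_zero_of_sphereRestrict_eq_zero P.1.2 hP
  have hspan : LinearMap.range g ≤ Submodule.span ℝ (Set.range (Y ℓ)) := by
    rintro _ ⟨P, rfl⟩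
    obtain ⟨a, ha⟩ := hY ℓ (g P) ⟨P.1.1, P.1.2, by
      rw [← laplacian_apply]
      exact P.2, fun x => sphereRestrict_apply _ x⟩
    have : g P = ∑ k, a k • Y ℓ k := by
      ext x
      simp [ha]
    rw [this]
    exact Submodule.sum_mem _ fun k _ =>
      Submodule.smul_mem _ _ (Submodule.subset_span ⟨k, rfl⟩)
  have : FiniteDimensional ℝ (Submodule.span ℝ (Set.range (Y ℓ))) :=
    FiniteDimensional.span_of_finite ℝ (Set.finite_range _)
  calc Module.finrank ℝ (LinearMap.ker T) = Module.finrank ℝ (LinearMap.range g) :=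
        (LinearMap.finrank_range_of_inj hg).symm
    _ ≤ Module.finrank ℝ (Submodule.span ℝ (Set.range (Y ℓ))) := Submodule.finrank_mono hspan
    _ ≤ Fintype.card (Fin (d ℓ)) := finrank_range_le_card _
    _ = d ℓ := Fintype.card_fin _

lemma laplacian_isHomogeneous {q ℓ : ℕ} {P : MvPolynomial (Fin (q + 1)) ℝ}
    (hP : P.IsHomogeneous (ℓ + 2)) : (laplacian q P).IsHomogeneous ℓ := by
  rw [laplacian_apply]
  exact IsHomogeneous.sum _ _ _ fun i _ => hP.pderiv.pderiv

lemma laplacian_eq_zero {q ℓ : ℕ} (hℓ : ℓ < 2) {P : MvPolynomial (Fin (q + 1)) ℝ}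
    (hP : P.IsHomogeneous ℓ) : laplacian q P = 0 := by
  rw [laplacian_apply]
  refine Finset.sum_eq_zero fun i _ => ?_
  have h1 : (pderiv i P).IsHomogeneous 0 := by
    have := hP.pderiv (i := i)
    rwa [show ℓ - 1 = 0 by omega] at this
  have h2 := totalDegree_eq_zero_iff_eq_C.mp ((totalDegree_zero_iff_isHomogeneous _).mpr h1)
  rw [h2, pderiv_C]

lemma finrank_homogeneous_le_sum {q : ℕ} {d : ℕ → ℕ} {Y : (ℓ : ℕ) → Fin (d ℓ) → Sph q → ℝ}
    (hY : ∀ (ℓ : ℕ) (f : Sph q → ℝ), IsSphHarm q ℓ f →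
      ∃ a : Fin (d ℓ) → ℝ, ∀ x, f x = ∑ k, a k * Y ℓ k x) (n : ℕ) :
    Module.finrank ℝ (homogeneousSubmodule (Fin (q + 1)) ℝ n) ≤ ∑ ℓ ∈ range (n + 1), d ℓ := by
  have hbase : ∀ n < 2, Module.finrank ℝ (homogeneousSubmodule (Fin (q + 1)) ℝ n) ≤
      ∑ ℓ ∈ range (n + 1), d ℓ := by
    intro n hn
    have h1 := finrank_homogeneous_le hY n
    have h2 : (laplacian q).domRestrict (homogeneousSubmodule (Fin (q + 1)) ℝ n) = 0 := by
      ext1 P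
      exact laplacian_eq_zero hn P.2
    rw [h2, LinearMap.range_zero, finrank_bot, zero_add] at h1
    exact h1.trans (Finset.single_le_sum (f := d) (fun _ _ => Nat.zero_le _)
      (Finset.self_mem_range_succ n))
  induction n using Nat.twoStepInduction with
  | zero => exact hbase 0 (by norm_num)
  | one => exact hbase 1 (by norm_num)
  | more n ih _ =>
    have h1 := finrank_homogeneous_le hY (n + 2)
    have h2 : LinearMap.range ((laplacian q).domRestrict
        (homogeneousSubmodule (Fin (q + 1)) ℝ (n + 2))) ≤
        homogeneousSubmodule (Fin (q + 1)) ℝ n := by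
      rintro _ ⟨P, rfl⟩
      exact laplacian_isHomogeneous P.2
    have h3 := Submodule.finrank_mono h2
    rw [Finset.sum_range_succ, Finset.sum_range_succ]
    omega

lemma pow_le_finrank_homogeneous {q m n : ℕ} (hmn : q * m ≤ n) :
    (m + 1) ^ q ≤ Module.finrank ℝ (homogeneousSubmodule (Fin (q + 1)) ℝ n) := by
  let e : (Fin q → Fin (m + 1)) → (Fin (q + 1) →₀ ℕ) := fun a =>
    Finsupp.equivFunOnFinite.symm (Fin.cons (n - ∑ i, (a i : ℕ)) fun i => (a i : ℕ))
  have he : Function.Injective e := by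
    intro a b hab
    have h1 := (Fin.cons_injective2 (Finsupp.equivFunOnFinite.symm.injective hab)).2
    ext i
    exact congrFun h1 i
  have hdeg : ∀ a, (e a).degree = n := by
    intro a
    have h1 : ∑ i, (a i : ℕ) ≤ n := by
      calc ∑ i, (a i : ℕ) ≤ ∑ _i : Fin q, m := Finset.sum_le_sum fun i _ => by omega
        _ = q * m := by simp
        _ ≤ n := hmn
    rw [Finsupp.degree_eq_sum, Fin.sum_univ_succ]
    simp only [e, Finsupp.equivFunOnFinite_symm_apply_apply, Fin.cons_zero, Fin.cons_succ]
    omega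
  let v : (Fin q → Fin (m + 1)) → homogeneousSubmodule (Fin (q + 1)) ℝ n := fun a =>
    ⟨monomial (e a) 1, isHomogeneous_monomial _ (hdeg a)⟩
  have hv : LinearIndependent ℝ v := by
    apply LinearIndependent.of_comp (homogeneousSubmodule (Fin (q + 1)) ℝ n).subtype
    have := (basisMonomials (Fin (q + 1)) ℝ).linearIndependent.comp e he
    convert this using 1
    ext1 a
    simp [v]
  simpa using hv.fintype_card_le_finrank

/-- The restriction to the sphere of the monomial `x₀ ^ k * ∏ xᵢ₊₁ ^ aᵢ`. -/
def sphereMonomial {q : ℕ} (k : ℕ) (a : Fin q → ℕ) (x : Sph q) : ℝ :=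
  (x : Euc q) 0 ^ k * ∏ i, (x : Euc q) (Fin.succ i) ^ a i

/-- The monomials of partial degrees at most `n` which are at most linear in `x₀`. -/
def reducedMonomial (q n : ℕ) (s : (Fin q → Fin (n + 1)) × Fin 2) : Sph q → ℝ :=
  sphereMonomial s.2 fun i => s.1 i

lemma sphere_coord_zero_sq {q : ℕ} (x : Sph q) :
    (x : Euc q) 0 ^ 2 = 1 - ∑ i : Fin q, (x : Euc q) (Fin.succ i) ^ 2 := by
  have hx : ‖(x : Euc q)‖ = 1 := mem_sphere_zero_iff_norm.mp x.2
  have h := EuclideanSpace.real_norm_sq_eq (x : Euc q)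
  rw [hx, Fin.sum_univ_succ] at h
  linarith

lemma sphereMonomial_mem_span {q n : ℕ} (k : ℕ) (a : Fin q → ℕ) (hka : k + ∑ i, a i ≤ n) :
    sphereMonomial k a ∈ Submodule.span ℝ (Set.range (reducedMonomial q n)) := by
  induction k using Nat.strong_induction_on generalizing a with
  | _ k ih =>
    by_cases hk : k < 2
    · refine Submodule.subset_span ⟨(fun i => ⟨a i, ?_⟩, ⟨k, hk⟩), rfl⟩
      have := Finset.single_le_sum (f := a) (fun _ _ => Nat.zero_le _) (Finset.mem_univ i)
      omega
    · obtain ⟨m, rfl⟩ : ∃ m, k = m + 2 := ⟨k - 2, by omega⟩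
      have hred : (sphereMonomial (m + 2) a : Sph q → ℝ) = sphereMonomial m a -
          ∑ i, sphereMonomial m (a + Pi.single i 2 : Fin q → ℕ) := by
        ext x
        have hprod : ∀ i : Fin q, ∏ j, (x : Euc q) (Fin.succ j) ^ ((a + Pi.single i 2 : Fin q → ℕ) j) =
            (∏ j, (x : Euc q) (Fin.succ j) ^ a j) * (x : Euc q) (Fin.succ i) ^ 2 := by
          intro i
          simp only [Pi.add_apply, pow_add, Finset.prod_mul_distrib]
          congr 1
          rw [Finset.prod_eq_single i]
          · simp
          · intro j _ hj
            simp [hj]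
          · simp
        simp only [sphereMonomial, Pi.sub_apply, Finset.sum_apply, hprod]
        rw [pow_add, sphere_coord_zero_sq]
        simp only [← mul_assoc, ← Finset.mul_sum]
        ring
      rw [hred]
      refine Submodule.sub_mem _ (ih m (by omega) a (by omega))
        (Submodule.sum_mem _ fun i _ => ih m (by omega) _ ?_)
      simp only [Pi.add_apply, Finset.sum_add_distrib, Finset.sum_pi_single', Finset.mem_univ,
        if_true]
      omega

lemma IsSphHarm.mem_span {q ℓ n : ℕ} (hℓ : ℓ ≤ n) {f : Sph q → ℝ} (hf : IsSphHarm q ℓ f) :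
    f ∈ Submodule.span ℝ (Set.range (reducedMonomial q n)) := by
  obtain ⟨P, hP, -, hfP⟩ := hf
  have hsum : f = ∑ s ∈ P.support, P.coeff s • sphereMonomial (s 0) fun i => s (Fin.succ i) := by
    ext x
    rw [hfP, eval_eq']
    simp [sphereMonomial, Fin.prod_univ_succ]
  rw [hsum]
  refine Submodule.sum_mem _ fun s hs => Submodule.smul_mem _ _ (sphereMonomial_mem_span _ _ ?_)
  have h1 : s.degree = ℓ := by
    by_contra hne
    exact (mem_support_iff.mp hs) (hP.coeff_eq_zero hne)
  rw [Finsupp.degree_eq_sum, Fin.sum_univ_succ] at h1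
  omega

lemma IsSphHarm.continuous {q ℓ : ℕ} {f : Sph q → ℝ} (hf : IsSphHarm q ℓ f) : Continuous f := by
  obtain ⟨P, -, -, hfP⟩ := hf
  rw [show f = fun x : Sph q => eval (fun i => (x : Euc q) i) P from _root_.funext hfP]
  have hc : Continuous fun (x : Sph q) i => (x : Euc q) i := by fun_prop
  exact (MvPolynomial.continuous_eval P).comp hc

lemma pderiv_bind₁ {σ τ : Type*} [Fintype σ] (f : σ → MvPolynomial τ ℝ) (i : τ)
    (P : MvPolynomial σ ℝ) :
    pderiv i (bind₁ f P) = ∑ j, bind₁ f (pderiv j P) * pderiv i (f j) := by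
  classical
  induction P using MvPolynomial.induction_on with
  | C a => simp
  | add p r hp hr => simp [hp, hr, add_mul, Finset.sum_add_distrib]
  | mul_X p k hp =>
    simp only [map_mul, bind₁_X_right, pderiv_mul, hp, map_add, pderiv_X, add_mul,
      Finset.sum_add_distrib, Finset.sum_mul]
    congr 1
    · exact Finset.sum_congr rfl fun j _ => by ring
    · rw [Finset.sum_eq_single k]
      · simp
      · intro j _ hj
        simp [hj.symm]
      · simp

lemma laplacian_bind₁ {q : ℕ} {A : Matrix (Fin (q + 1)) (Fin (q + 1)) ℝ} (hA : A * A.transpose = 1)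
    (P : MvPolynomial (Fin (q + 1)) ℝ) :
    laplacian q (bind₁ (fun j => ∑ i, C (A j i) * X i) P) =
      bind₁ (fun j => ∑ i, C (A j i) * X i) (laplacian q P) := by
  classical
  set f : Fin (q + 1) → MvPolynomial (Fin (q + 1)) ℝ := fun j => ∑ i, C (A j i) * X i with hf
  have hpf : ∀ i j, pderiv i (f j) = C (A j i) := by
    intro i j
    simp only [hf, map_sum, pderiv_C_mul, pderiv_X]
    rw [Finset.sum_eq_single i]
    · simp
    · intro k _ hk
      simp [hk]
    · simp
  have horth : ∀ j k, ∑ i, A k i * A j i = if k = j then 1 else 0 := by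
    intro j k
    have := congrFun (congrFun hA k) j
    rwa [Matrix.mul_apply, Matrix.one_apply] at this
  rw [laplacian_apply, laplacian_apply]
  simp only [pderiv_bind₁, hpf, map_sum, mul_comm _ (C _), pderiv_C_mul]
  simp only [Finset.mul_sum, ← mul_assoc, ← C_mul]
  rw [Finset.sum_comm]
  refine Finset.sum_congr rfl fun j _ => ?_
  rw [Finset.sum_comm]
  simp only [← Finset.sum_mul, ← map_sum, mul_comm (A j _), horth]
  rw [Finset.sum_eq_single j]
  · simp
  · intro k _ hk
    simp [hk]
  · simp

lemma IsSphHarm.comp_rotate {q ℓ : ℕ} {f : Sph q → ℝ} (hf : IsSphHarm q ℓ f)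
    (R : Euc q ≃ₗᵢ[ℝ] Euc q) : IsSphHarm q ℓ fun x => f (rotate R x) := by
  classical
  obtain ⟨P, hP, hΔ, hfP⟩ := hf
  let e : Fin (q + 1) → Euc q := fun j => EuclideanSpace.single j 1
  let A : Matrix (Fin (q + 1)) (Fin (q + 1)) ℝ := Matrix.of fun j i => (R.symm (e j)) i
  have hA : A * A.transpose = 1 := by
    ext j k
    rw [Matrix.mul_apply, Matrix.one_apply]
    have h1 : inner ℝ (R.symm (e k)) (R.symm (e j)) = if j = k then (1 : ℝ) else 0 := by
      rw [LinearIsometryEquiv.inner_map_map]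
      rw [EuclideanSpace.inner_single_left]
      simp [e, eq_comm]
    rw [← h1, PiLp.inner_apply]
    simp [A]
  have hRx : ∀ (x : Euc q) j, R x j = ∑ i, A j i * x i := by
    intro x j
    have h1 : inner ℝ (e j) (R x) = R x j := by
      rw [EuclideanSpace.inner_single_left]
      simp
    rw [← h1, ← R.symm.inner_map_map, R.symm_apply_apply, PiLp.inner_apply]
    simp [A, mul_comm]
  refine ⟨bind₁ (fun j => ∑ i, C (A j i) * X i) P, ?_, ?_, fun x => ?_⟩
  · have := hP.aeval (fun j => ∑ i, C (A j i) * X i) (n := 1)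
      fun j => IsHomogeneous.sum _ _ _ fun i _ => isHomogeneous_C_mul_X _ _
    rwa [one_mul] at this
  · rw [← laplacian_apply, laplacian_bind₁ hA, laplacian_apply, hΔ, map_zero]
  · change f (rotate R x) = _
    rw [hfP]
    change _ = eval₂Hom (RingHom.id ℝ) _ _
    rw [eval₂Hom_bind₁]
    change eval _ P = eval _ P
    congr 2
    ext j
    simp [rotate, hRx]

section Basis

variable {q : ℕ} {μ : Measure (Sph q)} {d : ℕ → ℕ} {Y : (ℓ : ℕ) → Fin (d ℓ) → Sph q → ℝ}

lemma GoodBasis.continuous (hY : GoodBasis q μ d Y) (ℓ : ℕ) (k : Fin (d ℓ)) :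
    Continuous (Y ℓ k) :=
  (hY.1 ℓ k).continuous

lemma integrable_of_continuous [IsFiniteMeasure μ] {f : Sph q → ℝ} (hf : Continuous f) :
    Integrable f μ :=
  hf.integrable_of_hasCompactSupport (HasCompactSupport.of_compactSpace f)

lemma continuous_rotate (R : Euc q ≃ₗᵢ[ℝ] Euc q) : Continuous (rotate R) :=
  (R.continuous.comp continuous_subtype_val).subtype_mk _

lemma RotInvariant.integral_rotate (hrot : RotInvariant q μ) (R : Euc q ≃ₗᵢ[ℝ] Euc q)
    {f : Sph q → ℝ} (hf : Continuous f) : ∫ x, f (rotate R x) ∂μ = ∫ x, f x ∂μ := by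
  conv_rhs => rw [← hrot R]
  exact (integral_map (continuous_rotate R).aemeasurable
    hf.measurable.aestronglyMeasurable).symm

lemma exists_rotate_eq (x y : Sph q) : ∃ R : Euc q ≃ₗᵢ[ℝ] Euc q, rotate R x = y := by
  have hxy : ‖(x : Euc q)‖ = ‖(y : Euc q)‖ := by
    rw [mem_sphere_zero_iff_norm.mp x.2, mem_sphere_zero_iff_norm.mp y.2]
  exact ⟨(ℝ ∙ ((x : Euc q) - y))ᗮ.reflection, Subtype.ext (Submodule.reflection_sub hxy)⟩

lemma GoodBasis.integral_sq (hY : GoodBasis q μ d Y) [IsFiniteMeasure μ] {ι : Type*}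
    (s : Finset ι) (t : ι → Σ ℓ, Fin (d ℓ)) (ht : Function.Injective t) (b : ι → ℝ) :
    ∫ x, (∑ i ∈ s, b i * Y (t i).1 (t i).2 x) ^ 2 ∂μ = ∑ i ∈ s, b i ^ 2 := by
  classical
  have hc := hY.continuous
  have horth : ∀ i j, ∫ x, Y (t i).1 (t i).2 x * Y (t j).1 (t j).2 x ∂μ =
      if i = j then 1 else 0 := by
    intro i j
    rw [hY.2.1]
    congr 1
    rw [eq_iff_iff, ← ht.eq_iff]
    generalize t i = u
    generalize t j = v
    obtain ⟨ℓ, k⟩ := u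
    obtain ⟨ℓ', k'⟩ := v
    constructor
    · rintro ⟨h1, h2⟩
      dsimp only at h1
      subst h1
      exact congrArg _ (Fin.ext h2)
    · rintro h
      cases h
      exact ⟨rfl, rfl⟩
  have hexp : ∀ x, (∑ i ∈ s, b i * Y (t i).1 (t i).2 x) ^ 2 =
      ∑ i ∈ s, ∑ j ∈ s, b i * b j * (Y (t i).1 (t i).2 x * Y (t j).1 (t j).2 x) := by
    intro x
    rw [sq, Finset.sum_mul_sum]
    exact Finset.sum_congr rfl fun i _ => Finset.sum_congr rfl fun j _ => by ring
  simp only [hexp]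
  rw [integral_finsetSum _ fun i _ => integrable_of_continuous (by fun_prop)]
  refine Finset.sum_congr rfl fun i hi => ?_
  rw [integral_finsetSum _ fun i _ => integrable_of_continuous (by fun_prop)]
  simp only [integral_const_mul, horth]
  simp [hi, sq]

lemma GoodBasis.sum_sq_rotate (hY : GoodBasis q μ d Y) [IsFiniteMeasure μ]
    (hrot : RotInvariant q μ) (R : Euc q ≃ₗᵢ[ℝ] Euc q) (ℓ : ℕ) (x : Sph q) :
    ∑ k, Y ℓ k (rotate R x) ^ 2 = ∑ k, Y ℓ k x ^ 2 := by
  classical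
  have hc := hY.continuous
  choose a ha using fun k => hY.2.2 ℓ _ ((hY.1 ℓ k).comp_rotate R)
  let A : Matrix (Fin (d ℓ)) (Fin (d ℓ)) ℝ := Matrix.of a
  have horth : ∀ k k', ∫ x, Y ℓ k x * Y ℓ k' x ∂μ = if k = k' then 1 else 0 := by
    intro k k'
    rw [hY.2.1]
    simp [Fin.ext_iff]
  have hA : A * A.transpose = 1 := by
    ext k k'
    rw [Matrix.mul_apply, Matrix.one_apply, ← horth,
      ← hrot.integral_rotate R (f := fun x => Y ℓ k x * Y ℓ k' x) ((hc ℓ k).mul (hc ℓ k'))]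
    have hexp : ∀ x, Y ℓ k (rotate R x) * Y ℓ k' (rotate R x) =
        ∑ i, ∑ j, a k i * a k' j * (Y ℓ i x * Y ℓ j x) := by
      intro x
      rw [ha, ha, Finset.sum_mul_sum]
      exact Finset.sum_congr rfl fun i _ => Finset.sum_congr rfl fun j _ => by ring
    simp only [hexp]
    rw [integral_finsetSum _ fun i _ => integrable_of_continuous (by fun_prop)]
    refine Finset.sum_congr rfl fun i _ => ?_
    rw [integral_finsetSum _ fun i _ => integrable_of_continuous (by fun_prop)]
    simp only [integral_const_mul, horth]
    simp [A]
  have hA' : A.transpose * A = 1 := mul_eq_one_comm.mp hA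
  have hv : (fun k => Y ℓ k (rotate R x)) = A.mulVec fun k => Y ℓ k x := by
    ext k
    rw [ha]
    rfl
  have hdot : ∀ v : Fin (d ℓ) → ℝ, ∑ k, v k ^ 2 = v ⬝ᵥ v := fun v => by
    simp [dotProduct, sq]
  rw [hdot fun k => Y ℓ k (rotate R x), hdot fun k => Y ℓ k x, hv, Matrix.dotProduct_mulVec,
    Matrix.vecMul_mulVec, hA', Matrix.vecMul_one]

lemma GoodBasis.sum_sq_eq (hY : GoodBasis q μ d Y) [IsProbabilityMeasure μ]
    (hrot : RotInvariant q μ) (ℓ : ℕ) (x : Sph q) : ∑ k, Y ℓ k x ^ 2 = d ℓ := by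
  have hc := hY.continuous
  have hconst : ∀ y, ∑ k, Y ℓ k y ^ 2 = ∑ k, Y ℓ k x ^ 2 := by
    intro y
    obtain ⟨R, rfl⟩ := exists_rotate_eq x y
    exact hY.sum_sq_rotate hrot R ℓ x
  have h1 : ∫ y, ∑ k, Y ℓ k y ^ 2 ∂μ = ∑ k, Y ℓ k x ^ 2 := by
    simp [hconst]
  rw [← h1, integral_finsetSum _ fun i _ => integrable_of_continuous (by fun_prop)]
  simp only [sq, hY.2.1]
  simp

lemma GoodBasis.linearIndependent (hY : GoodBasis q μ d Y) [IsFiniteMeasure μ] (n : ℕ) :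
    LinearIndependent ℝ fun s : Σ ℓ : Fin (n + 1), Fin (d ℓ) => Y s.1 s.2 := by
  rw [Fintype.linearIndependent_iff]
  intro b hb s
  have h1 := hY.integral_sq Finset.univ
    (fun s : Σ ℓ : Fin (n + 1), Fin (d ℓ) => (⟨s.1, s.2⟩ : Σ ℓ, Fin (d ℓ))) (by
      rintro ⟨ℓ, k⟩ ⟨ℓ', k'⟩ h
      rw [Sigma.mk.injEq] at h
      obtain ⟨h1, h2⟩ := h
      obtain rfl := Fin.ext h1
      exact congrArg _ (eq_of_heq h2)) b
  have h2 : ∀ x, ∑ s : Σ ℓ : Fin (n + 1), Fin (d ℓ), b s * Y s.1 s.2 x = 0 := by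
    intro x
    simpa using congrFun hb x
  simp only [h2] at h1
  rw [zero_pow two_ne_zero, integral_zero, eq_comm,
    Finset.sum_eq_zero_iff_of_nonneg fun i _ => sq_nonneg _] at h1
  exact pow_eq_zero_iff two_ne_zero |>.mp (h1 s (Finset.mem_univ s))

lemma GoodBasis.sum_dim_le (hY : GoodBasis q μ d Y) [IsFiniteMeasure μ] (n : ℕ) :
    ∑ ℓ ∈ range (n + 1), d ℓ ≤ 2 * (n + 1) ^ q := by
  have hli := hY.linearIndependent n
  have hspan : Submodule.span ℝ (Set.range fun s : Σ ℓ : Fin (n + 1), Fin (d ℓ) => Y s.1 s.2) ≤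
      Submodule.span ℝ (Set.range (reducedMonomial q n)) := by
    rw [Submodule.span_le]
    rintro _ ⟨s, rfl⟩
    exact (hY.1 s.1 s.2).mem_span (Nat.le_of_lt_succ s.1.2)
  have : FiniteDimensional ℝ (Submodule.span ℝ (Set.range (reducedMonomial q n))) :=
    FiniteDimensional.span_of_finite ℝ (Set.finite_range _)
  have h1 := (Submodule.finrank_mono hspan).trans (finrank_range_le_card _)
  rw [finrank_span_eq_card hli] at h1
  rw [Finset.sum_range]
  simpa [mul_comm] using h1

lemma GoodBasis.pow_le_sum_dim (hY : GoodBasis q μ d Y) {m n : ℕ} (hmn : q * m ≤ n) :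
    (m + 1) ^ q ≤ ∑ ℓ ∈ range (n + 1), d ℓ :=
  (pow_le_finrank_homogeneous hmn).trans (finrank_homogeneous_le_sum hY.2.2 n)

lemma GoodBasis.integral_Phi_sq (hY : GoodBasis q μ d Y) [IsProbabilityMeasure μ]
    (hrot : RotInvariant q μ) (h : ℝ → ℝ) (n : ℕ) (x : Sph q) :
    ∫ ξ, Phi d Y h n x ξ ^ 2 ∂μ = ∑ ℓ ∈ range (n + 1), h (ℓ / n) ^ 2 * d ℓ := by
  have h1 := hY.integral_sq ((range (n + 1)).sigma fun ℓ => (Finset.univ : Finset (Fin (d ℓ))))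
    id Function.injective_id fun s => h (s.1 / n) * Y s.1 s.2 x
  simp only [Finset.sum_sigma, id, mul_pow, ← Finset.mul_sum, hY.sum_sq_eq hrot] at h1
  rw [← h1]
  refine integral_congr_ae (Filter.Eventually.of_forall fun ξ => ?_)
  simp only [Phi, Finset.mul_sum, mul_assoc]

lemma GoodBasis.Phi_self (hY : GoodBasis q μ d Y) [IsProbabilityMeasure μ]
    (hrot : RotInvariant q μ) (h : ℝ → ℝ) (n : ℕ) (x : Sph q) :
    Phi d Y h n x x = ∑ ℓ ∈ range (n + 1), h (ℓ / n) * d ℓ := by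
  simp only [Phi, ← sq, hY.sum_sq_eq hrot]

lemma GoodBasis.abs_sum_mul_le (hY : GoodBasis q μ d Y) [IsProbabilityMeasure μ]
    (hrot : RotInvariant q μ) (ℓ : ℕ) (x ξ : Sph q) : |∑ k, Y ℓ k x * Y ℓ k ξ| ≤ d ℓ := by
  refine abs_le_of_sq_le_sq ?_ (Nat.cast_nonneg _)
  have h1 := Finset.sum_mul_sq_le_sq_mul_sq Finset.univ (fun k => Y ℓ k x) fun k => Y ℓ k ξ
  rwa [hY.sum_sq_eq hrot, hY.sum_sq_eq hrot, ← sq] at h1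

/-- Two-sided bounds for sums of the dimensions against weights which are `1` on `[0, 1/2]`. -/
lemma GoodBasis.weighted_sum_bounds (hY : GoodBasis q μ d Y) [IsFiniteMeasure μ] (hq : 1 ≤ q)
    {g : ℝ → ℝ} (h1 : ∀ x, 0 ≤ x → x ≤ 1 / 2 → g x = 1) (h0 : ∀ x, 0 ≤ x → 0 ≤ g x)
    (hle : ∀ x, 0 ≤ x → g x ≤ 1) {n : ℕ} (hn : 1 ≤ n) :
    (1 / (2 * q) : ℝ) ^ q * (n : ℝ) ^ q ≤ ∑ ℓ ∈ range (n + 1), g (ℓ / n) * d ℓ ∧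
      ∑ ℓ ∈ range (n + 1), g (ℓ / n) * d ℓ ≤ 2 * 2 ^ q * (n : ℝ) ^ q := by
  have hn' : (1 : ℝ) ≤ n := by exact_mod_cast hn
  have hpos : ∀ ℓ : ℕ, (0 : ℝ) ≤ ℓ / n := fun ℓ => by positivity
  constructor
  · set m := n / (2 * q)
    have hm : q * m ≤ n / 2 := by
      rw [Nat.le_div_iff_mul_le two_pos]
      calc q * m * 2 = m * (2 * q) := by ring
        _ ≤ n := Nat.div_mul_le_self _ _
    have h2 : (n : ℝ) ≤ (2 * q) * (m + 1) := by
      have := (Nat.lt_mul_div_succ n (show 0 < 2 * q by omega)).le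
      exact_mod_cast this
    have hq' : (0 : ℝ) < 2 * q := by positivity
    calc (1 / (2 * q) : ℝ) ^ q * (n : ℝ) ^ q = (1 / (2 * q) * n : ℝ) ^ q := by rw [mul_pow]
      _ ≤ ((m : ℝ) + 1) ^ q := by
          gcongr
          rw [one_div, inv_mul_le_iff₀ hq']
          exact h2
      _ ≤ ∑ ℓ ∈ range (n / 2 + 1), (d ℓ : ℝ) := by exact_mod_cast hY.pow_le_sum_dim hm
      _ = ∑ ℓ ∈ range (n / 2 + 1), g (ℓ / n) * d ℓ := by
          refine Finset.sum_congr rfl fun ℓ hℓ => ?_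
          rw [h1 _ (hpos ℓ), one_mul]
          rw [div_le_iff₀ (by linarith)]
          have h3 : 2 * ℓ ≤ n := by
            have := Finset.mem_range.mp hℓ
            omega
          have h4 : (2 * ℓ : ℝ) ≤ n := by exact_mod_cast h3
          linarith
      _ ≤ ∑ ℓ ∈ range (n + 1), g (ℓ / n) * d ℓ :=
          Finset.sum_le_sum_of_subset_of_nonneg (Finset.range_subset_range.mpr (by omega))
            fun ℓ _ _ => mul_nonneg (h0 _ (hpos ℓ)) (Nat.cast_nonneg _)
  · calc ∑ ℓ ∈ range (n + 1), g (ℓ / n) * d ℓ ≤ ∑ ℓ ∈ range (n + 1), (d ℓ : ℝ) :=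
          Finset.sum_le_sum fun ℓ _ =>
            mul_le_of_le_one_left (Nat.cast_nonneg _) (hle _ (hpos ℓ))
      _ ≤ 2 * ((n : ℝ) + 1) ^ q := by exact_mod_cast hY.sum_dim_le n
      _ ≤ 2 * (2 * (n : ℝ)) ^ q := by
          gcongr
          linarith
      _ = 2 * 2 ^ q * (n : ℝ) ^ q := by rw [mul_pow, mul_assoc]

end Basis

/-- Two–sided bounds `∫ Φ_n(h;x·ξ)² dμ_q(ξ) ≍ n^q ≍ Φ_n(h;1) = max_ξ |Φ_n(h;x·ξ)|`. -/
theorem statement2 (q S : ℕ) (hq : 1 ≤ q) (hSq : q ≤ S) (h : ℝ → ℝ) (hh : GoodH S h)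
    (μ : Measure (Sph q)) (hμ : IsProbabilityMeasure μ) (hrot : RotInvariant q μ)
    (d : ℕ → ℕ) (Y : (ℓ : ℕ) → Fin (d ℓ) → Sph q → ℝ) (hY : GoodBasis q μ d Y) :
    ∃ c c' : ℝ, 0 < c ∧ 0 < c' ∧ ∀ n : ℕ, 1 ≤ n → ∀ x : Sph q,
      (c * (n : ℝ) ^ q ≤ ∫ ξ, (Phi d Y h n x ξ) ^ 2 ∂μ ∧
        (∫ ξ, (Phi d Y h n x ξ) ^ 2 ∂μ) ≤ c' * (n : ℝ) ^ q) ∧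
      (∀ ξ : Sph q, |Phi d Y h n x ξ| ≤ Phi d Y h n x x) ∧
      (c * (n : ℝ) ^ q ≤ Phi d Y h n x x ∧ Phi d Y h n x x ≤ c' * (n : ℝ) ^ q) := by
  obtain ⟨h1, h2, hmono, -⟩ := hh
  have h0 : ∀ x, 0 ≤ x → 0 ≤ h x := fun x hx => by
    rw [← h2 (x + 2) (by linarith)]
    exact hmono x (x + 2) hx (by linarith)
  have hle : ∀ x, 0 ≤ x → h x ≤ 1 := fun x hx => by
    rw [← h1 0 le_rfl (by norm_num)]
    exact hmono 0 x le_rfl hx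
  refine ⟨(1 / (2 * q)) ^ q, 2 * 2 ^ q, by positivity, by positivity,
    fun n hn x => ⟨?_, fun ξ => ?_, ?_⟩⟩
  · rw [hY.integral_Phi_sq hrot]
    exact hY.weighted_sum_bounds hq (g := fun x => h x ^ 2)
      (fun x hx hx' => by rw [h1 x hx hx', one_pow]) (fun x _ => sq_nonneg _)
      (fun x hx => pow_le_one₀ (h0 x hx) (hle x hx)) hn
  · rw [hY.Phi_self hrot, Phi]
    refine (Finset.abs_sum_le_sum_abs _ _).trans (Finset.sum_le_sum fun ℓ _ => ?_)
    have hpos : 0 ≤ h (ℓ / n) := h0 _ (by positivity)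
    rw [abs_mul, abs_of_nonneg hpos]
    exact mul_le_mul_of_nonneg_left (hY.abs_sum_mul_le hrot ℓ x ξ) hpos
  · rw [hY.Phi_self hrot]
    exact hY.weighted_sum_bounds hq h1 h0 hle hn

end SD
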